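/- arXiv:2003.13461 — 5 statements merged into one kernel-verified Lean document; each statement's English description precedes it below -/
import Mathlib

section
/- Let E be a real inner product space, let n ≥ 1, and let f₁,…,f_n : E → ℝ be differentiable with L-Lipschitz gradients (L ≥ 0); set F = (1/n)·Σ_{j=1}^n f_j. Let ζ₁,…,ζ_n ≥ 0 satisfy ‖∇F(x) − ∇f_j(x)‖² ≤ ζ_j for all x ∈ E and all j. Fix an index i, a nonempty subset U of {1,…,n} of cardinality K, and points v_i*, w* ∈ E. Then for all v, w ∈ E: ‖∇f_i(v) − (1/K)·Σ_{j∈U} ∇f_j(w)‖² ≤ 2L²·‖v − v_i*‖² + 6·(2ζ_i + (2/K)·Σ_{j∈U} ζ_j) + 6L²·‖w − w*‖² + 6L²·‖v_i* − w*‖². -/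
/-- The squared norm of an average is at most the average of the squared norms. -/
theorem norm_sq_average_le {ι E : Type*} [NormedAddCommGroup E] [NormedSpace ℝ E]
    (U : Finset ι) (x : ι → E) :
    ‖(1 / (U.card : ℝ)) • ∑ j ∈ U, x j‖ ^ 2 ≤ (1 / (U.card : ℝ)) * ∑ j ∈ U, ‖x j‖ ^ 2 := by
  obtain rfl | hU := U.eq_empty_or_nonempty
  · simp
  have hc : (0 : ℝ) < U.card := by exact_mod_cast hU.card_pos
  have hsum : ‖∑ j ∈ U, x j‖ ^ 2 ≤ U.card * ∑ j ∈ U, ‖x j‖ ^ 2 :=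
    (pow_le_pow_left₀ (norm_nonneg _) (norm_sum_le U x) 2).trans sq_sum_le_card_mul_sum_sq
  rw [norm_smul, mul_pow, Real.norm_of_nonneg (by positivity)]
  calc (1 / (U.card : ℝ)) ^ 2 * ‖∑ j ∈ U, x j‖ ^ 2
      ≤ (1 / (U.card : ℝ)) ^ 2 * (U.card * ∑ j ∈ U, ‖x j‖ ^ 2) := by gcongr
    _ = (1 / (U.card : ℝ)) * ∑ j ∈ U, ‖x j‖ ^ 2 := by field_simp

theorem norm_add_sq_le_two_mul {E : Type*} [SeminormedAddCommGroup E] (a b : E) :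
    ‖a + b‖ ^ 2 ≤ 2 * ‖a‖ ^ 2 + 2 * ‖b‖ ^ 2 := by
  have := pow_le_pow_left₀ (norm_nonneg _) (norm_add_le a b) 2
  nlinarith [sq_nonneg (‖a‖ - ‖b‖)]

theorem norm_add_add_sq_le_three_mul {E : Type*} [SeminormedAddCommGroup E] (a b c : E) :
    ‖a + b + c‖ ^ 2 ≤ 3 * (‖a‖ ^ 2 + ‖b‖ ^ 2 + ‖c‖ ^ 2) := by
  have := pow_le_pow_left₀ (norm_nonneg _) (norm_add₃_le (a := a) (b := b) (c := c)) 2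
  nlinarith [sq_nonneg (‖a‖ - ‖b‖), sq_nonneg (‖a‖ - ‖c‖), sq_nonneg (‖b‖ - ‖c‖)]

/-- sampled version of the local–global gradient gap bound. `F = (1/n)·Σ f_j`
is the global objective, `U` is the set of `K` sampled clients, and the gap between
client `i`'s gradient at `v` and the averaged sampled gradient at `w` is bounded by the
distances to `v_i*, w*`, gradient diversities, and the local–global optimality gap. -/
theorem local_global_gradient_gap_sampled
    {E : Type*} [NormedAddCommGroup E] [InnerProductSpace ℝ E]
    (n : ℕ) (hn : 1 ≤ n) (f : Fin n → E → ℝ) (gf : Fin n → E → E)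
    (L : ℝ) (hL : 0 ≤ L)
    (hgf : ∀ j x, HasFDerivAt (f j) (innerSL ℝ (gf j x)) x)
    (hLip : ∀ j x y, ‖gf j x - gf j y‖ ≤ L * ‖x - y‖)
    (gF : E → E)
    (hgF : ∀ x, HasFDerivAt (fun z => (1 / (n : ℝ)) * ∑ j, f j z) (innerSL ℝ (gF x)) x)
    (ζ : Fin n → ℝ) (hζ0 : ∀ j, 0 ≤ ζ j)
    (hζ : ∀ j x, ‖gF x - gf j x‖ ^ 2 ≤ ζ j)
    (i : Fin n) (U : Finset (Fin n)) (hU : U.Nonempty) (K : ℕ) (hK : U.card = K)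
    (vistar wstar : E) :
    ∀ v w : E,
      ‖gf i v - (1 / (K : ℝ)) • ∑ j ∈ U, gf j w‖ ^ 2
        ≤ 2 * L ^ 2 * ‖v - vistar‖ ^ 2
          + 6 * (2 * ζ i + (2 / (K : ℝ)) * ∑ j ∈ U, ζ j)
          + 6 * L ^ 2 * ‖w - wstar‖ ^ 2 + 6 * L ^ 2 * ‖vistar - wstar‖ ^ 2 := by
  intro v w
  subst hK
  have hc : (U.card : ℝ) ≠ 0 := by exact_mod_cast hU.card_pos.ne'
  have hLsq : ∀ x y, ‖gf i x - gf i y‖ ^ 2 ≤ L ^ 2 * ‖x - y‖ ^ 2 := fun x y => by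
    simpa only [mul_pow] using pow_le_pow_left₀ (norm_nonneg _) (hLip i x y) 2
  have havg : (1 / (U.card : ℝ)) • ∑ j ∈ U, (gF w - gf j w)
      = gF w - (1 / (U.card : ℝ)) • ∑ j ∈ U, gf j w := by
    rw [Finset.sum_sub_distrib, Finset.sum_const, smul_sub, ← Nat.cast_smul_eq_nsmul ℝ,
      smul_smul, one_div_mul_cancel hc, one_smul]
  have hdiv : ‖gf i w - (1 / (U.card : ℝ)) • ∑ j ∈ U, gf j w‖ ^ 2
      ≤ 2 * ζ i + (2 / (U.card : ℝ)) * ∑ j ∈ U, ζ j := by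
    have hsplit := norm_add_sq_le_two_mul (gf i w - gF w)
      (gF w - (1 / (U.card : ℝ)) • ∑ j ∈ U, gf j w)
    rw [sub_add_sub_cancel, norm_sub_rev (gf i w) (gF w), ← havg] at hsplit
    have hmean : (1 / (U.card : ℝ)) * ∑ j ∈ U, ‖gF w - gf j w‖ ^ 2
        ≤ (1 / (U.card : ℝ)) * ∑ j ∈ U, ζ j := by
      gcongr with j
      exact hζ j w
    have hjensen := norm_sq_average_le U fun j => gF w - gf j w
    have htwo : (2 / (U.card : ℝ)) * ∑ j ∈ U, ζ j
        = 2 * ((1 / (U.card : ℝ)) * ∑ j ∈ U, ζ j) := by ring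
    linarith [hζ i w]
  have houter := norm_add_sq_le_two_mul (gf i v - gf i vistar)
    (gf i vistar - (1 / (U.card : ℝ)) • ∑ j ∈ U, gf j w)
  have hinner := norm_add_add_sq_le_three_mul (gf i vistar - gf i wstar) (gf i wstar - gf i w)
    (gf i w - (1 / (U.card : ℝ)) • ∑ j ∈ U, gf j w)
  rw [sub_add_sub_cancel] at houter
  rw [sub_add_sub_cancel, sub_add_sub_cancel] at hinner
  have hw := hLsq wstar w
  rw [norm_sub_rev wstar w] at hw
  linarith [hLsq v vistar, hLsq vistar wstar]
end

section
/- Let μ > 0, let a ≥ 16 be a real number, let τ ≥ 1 be a natural number, and let t_c < t be natural numbers with t − t_c ≤ τ. Define the step sizes η_p = 16/(μ·(a+p)) for natural p. Then Σ_{p=t_c}^{t−1} η_p² · ∏_{q=p+1}^{t−1} (1 − μ·η_q) ≤ τ · η_{t−1}². -/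
/-- One step of decay brings the squared step size below the next squared step size. -/
lemma stepsize_sq_mul_decay_le {μ x : ℝ} (hμ : 0 < μ) (hx : 0 < x) :
    (16 / (μ * x)) ^ 2 * (1 - μ * (16 / (μ * (x + 1)))) ≤ (16 / (μ * (x + 1))) ^ 2 := by
  have h : (16 / (μ * (x + 1))) ^ 2 - (16 / (μ * x)) ^ 2 * (1 - μ * (16 / (μ * (x + 1))))
      = 256 * (14 * x + 15) / (μ ^ 2 * x ^ 2 * (x + 1) ^ 2) := by
    field_simp
    ring
  have h' : 0 ≤ 256 * (14 * x + 15) / (μ ^ 2 * x ^ 2 * (x + 1) ^ 2) := by positivity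
  linarith

/-- The squared step size at `p`, decayed through step `n`, is at most the one at `n`. -/
lemma stepsize_sq_mul_prod_decay_le {μ a : ℝ} (hμ : 0 < μ) (ha : 16 ≤ a) {p n : ℕ} (hpn : p ≤ n) :
    (16 / (μ * (a + (p : ℝ)))) ^ 2
        * ∏ q ∈ Finset.Ico (p + 1) (n + 1), (1 - μ * (16 / (μ * (a + (q : ℝ)))))
      ≤ (16 / (μ * (a + (n : ℝ)))) ^ 2 := by
  induction n, hpn using Nat.le_induction with
  | base => simp
  | succ n hpn ih =>
    have hx : 0 < a + (n : ℝ) := by positivity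
    have hdecay : 0 ≤ 1 - μ * (16 / (μ * (a + ((n + 1 : ℕ) : ℝ)))) := by
      rw [← mul_div_assoc, mul_div_mul_left _ _ hμ.ne', sub_nonneg, div_le_one (by positivity)]
      linarith [Nat.cast_nonneg (α := ℝ) (n + 1)]
    rw [Finset.prod_Ico_succ_top (by omega), ← mul_assoc]
    refine (mul_le_mul_of_nonneg_right ih hdecay).trans ?_
    simpa only [Nat.cast_add, Nat.cast_one, add_assoc] using stepsize_sq_mul_decay_le hμ hx

/-- with the learning rate schedule `η_p = 16/(μ(a+p))`, within a window of
at most `τ` local steps between synchronizations (iterations `t_c` to `t`), the weighted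
sum of squared step sizes with decay factors `(1 − μη_q)` is at most `τ·η_{t−1}²`. -/
theorem stepsize_window_bound
    (μ a : ℝ) (hμ : 0 < μ) (ha : 16 ≤ a)
    (τ : ℕ) (hτ : 1 ≤ τ) (tc t : ℕ) (htc : tc < t) (hwin : t - tc ≤ τ) :
    ∑ p ∈ Finset.Ico tc t,
        (16 / (μ * (a + (p : ℝ)))) ^ 2
          * ∏ q ∈ Finset.Ico (p + 1) t, (1 - μ * (16 / (μ * (a + (q : ℝ)))))
      ≤ (τ : ℝ) * (16 / (μ * (a + ((t - 1 : ℕ) : ℝ)))) ^ 2 := by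
  obtain ⟨n, rfl⟩ : ∃ n, t = n + 1 := ⟨t - 1, by omega⟩
  rw [Nat.add_sub_cancel]
  refine (Finset.sum_le_card_nsmul _ _ _ fun p hp =>
    stepsize_sq_mul_prod_decay_le hμ ha (Nat.lt_succ_iff.mp (Finset.mem_Ico.mp hp).2)).trans ?_
  rw [Nat.card_Ico, nsmul_eq_mul]
  gcongr
end

section
/- Let E be a complete real inner product space, n ≥ 1, and f₁,…,f_n : E → ℝ differentiable with L-Lipschitz gradients (L > 0); set F = (1/n)·Σ_j f_j. Fix points w, w₁,…,w_n ∈ E and σ ≥ 0. Let (Ω, P) be a probability space and g : Ω → E be Bochner integrable with ∫ g dP = (1/n)·Σ_j ∇f_j(w_j) and ∫ ‖g(ω) − (1/n)·Σ_j ∇f_j(w_j)‖² dP(ω) ≤ σ²/n. If 0 < η ≤ 1/L, ω ↦ F(w − η·g(ω)) is integrable, and ω ↦ ‖g(ω)‖² is integrable, then ∫ F(w − η·g(ω)) dP(ω) ≤ F(w) − (η/2)·‖∇F(w)‖² + η²·L·σ²/(2n) + (η·L²/2)·(1/n)·Σ_j ‖w_j − w‖². -/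
open MeasureTheory

open scoped InnerProductSpace

section Smoothness

variable {E : Type*} [NormedAddCommGroup E] [InnerProductSpace ℝ E]

/-- Jensen's inequality for the squared norm and a uniform average. -/
theorem norm_sq_average_le_s10 {n : ℕ} (v : Fin n → E) :
    ‖(1 / (n : ℝ)) • ∑ j, v j‖ ^ 2 ≤ (1 / (n : ℝ)) * ∑ j, ‖v j‖ ^ 2 := by
  rcases Nat.eq_zero_or_pos n with rfl | hn
  · simp
  have hn' : (0 : ℝ) < n := by exact_mod_cast hn
  have hsum : ‖∑ j, v j‖ ^ 2 ≤ n * ∑ j, ‖v j‖ ^ 2 := by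
    calc ‖∑ j, v j‖ ^ 2 ≤ (∑ j, ‖v j‖) ^ 2 := by
          gcongr
          exact norm_sum_le _ _
      _ ≤ n * ∑ j, ‖v j‖ ^ 2 := by
          simpa using sq_sum_le_card_mul_sum_sq (s := Finset.univ) (f := fun j => ‖v j‖)
  rw [norm_smul, mul_pow, Real.norm_of_nonneg (by positivity)]
  calc (1 / (n : ℝ)) ^ 2 * ‖∑ j, v j‖ ^ 2
      ≤ (1 / (n : ℝ)) ^ 2 * (n * ∑ j, ‖v j‖ ^ 2) := by gcongr
    _ = (1 / (n : ℝ)) * ∑ j, ‖v j‖ ^ 2 := by field_simp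

/-- The second moment of an `E`-valued random variable is its variance plus the squared norm of
its mean. -/
theorem integral_norm_sq_eq_variance_add [CompleteSpace E] {Ω : Type*} [MeasurableSpace Ω]
    (P : Measure Ω) [IsProbabilityMeasure P] {g : Ω → E} (hg : Integrable g P)
    (hg2 : Integrable (fun ω => ‖g ω‖ ^ 2) P) {m : E} (hm : ∫ ω, g ω ∂P = m) :
    ∫ ω, ‖g ω‖ ^ 2 ∂P = ∫ ω, ‖g ω - m‖ ^ 2 ∂P + ‖m‖ ^ 2 := by
  have hinner : Integrable (fun ω => 2 * ⟪m, g ω⟫_ℝ) P := (hg.const_inner m).const_mul 2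
  have hdiff : Integrable (fun ω => ‖g ω‖ ^ 2 - 2 * ⟪m, g ω⟫_ℝ) P := hg2.sub hinner
  have hexpand : ∀ ω, ‖g ω - m‖ ^ 2 = ‖g ω‖ ^ 2 - 2 * ⟪m, g ω⟫_ℝ + ‖m‖ ^ 2 := fun ω => by
    rw [norm_sub_sq_real, real_inner_comm]
  simp_rw [hexpand]
  rw [integral_add hdiff (integrable_const _), integral_sub hg2 hinner,
    integral_const_mul, integral_inner hg, hm, real_inner_self_eq_norm_sq]
  simp
  ring

variable [CompleteSpace E]

/-- Quadratic upper bound for a function with `L`-Lipschitz gradient. -/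
theorem le_add_inner_add_of_lipschitz_gradient {F : E → ℝ} {F' : E → E} {L : ℝ}
    (hF : ∀ x, HasGradientAt F (F' x) x) (hLip : ∀ x y, ‖F' x - F' y‖ ≤ L * ‖x - y‖)
    (w v : E) : F (w + v) ≤ F w + ⟪F' w, v⟫_ℝ + L / 2 * ‖v‖ ^ 2 := by
  set φ : ℝ → ℝ := fun t => F (w + t • v) - t * ⟪F' w, v⟫_ℝ - t ^ 2 * (L / 2 * ‖v‖ ^ 2)
  have hφ : ∀ t, HasDerivAt φ (⟪F' (w + t • v), v⟫_ℝ - 1 * ⟪F' w, v⟫_ℝ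
      - (2 * t) * (L / 2 * ‖v‖ ^ 2)) t := by
    intro t
    have hline : HasDerivAt (fun t : ℝ => w + t • v) v t := by
      simpa using ((hasDerivAt_id t).smul_const v).const_add w
    have hcomp : HasDerivAt (fun t : ℝ => F (w + t • v)) ⟪F' (w + t • v), v⟫_ℝ t := by
      simpa [Function.comp_def] using (hF (w + t • v)).hasFDerivAt.comp_hasDerivAt t hline
    have hsq : HasDerivAt (fun t : ℝ => t ^ 2) (2 * t) t := by
      simpa using hasDerivAt_pow 2 t
    exact (hcomp.sub ((hasDerivAt_id t).mul_const _)).sub (hsq.mul_const _)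
  have hanti : AntitoneOn φ (Set.Icc 0 1) := by
    refine antitoneOn_of_deriv_nonpos (convex_Icc 0 1)
      (fun t _ => (hφ t).continuousAt.continuousWithinAt)
      (fun t _ => (hφ t).differentiableAt.differentiableWithinAt) fun t ht => ?_
    rw [interior_Icc] at ht
    rw [(hφ t).deriv]
    have hbound : ⟪F' (w + t • v) - F' w, v⟫_ℝ ≤ L * (t * ‖v‖) * ‖v‖ := by
      refine (real_inner_le_norm _ _).trans ?_
      gcongr
      simpa [norm_smul, abs_of_pos ht.1] using hLip (w + t • v) w
    rw [inner_sub_left] at hbound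
    linarith
  have h01 := hanti (Set.left_mem_Icc.2 zero_le_one) (Set.right_mem_Icc.2 zero_le_one) zero_le_one
  simp only [φ, one_smul, zero_smul, add_zero] at h01
  linarith

end Smoothness

/-- descent lemma for the global model update. `g` is the averaged stochastic
gradient computed at the local copies `w_j` of the global model `w`, unbiased for
`(1/n)·Σ_j ∇f_j(w_j)` with variance at most `σ²/n`; one step `w − η·g` decreases the
global objective `F = (1/n)·Σ_j f_j` in expectation up to variance and deviation terms. -/
theorem global_descent_step
    {E : Type*} [NormedAddCommGroup E] [InnerProductSpace ℝ E] [CompleteSpace E]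
    (n : ℕ) (hn : 1 ≤ n) (f : Fin n → E → ℝ) (gf : Fin n → E → E)
    (L : ℝ) (hL : 0 < L)
    (hgf : ∀ j x, HasGradientAt (f j) (gf j x) x)
    (hLip : ∀ j x y, ‖gf j x - gf j y‖ ≤ L * ‖x - y‖)
    (F : E → ℝ) (hF : F = fun z => (1 / (n : ℝ)) * ∑ j, f j z)
    (gF : E → E) (hgF : ∀ x, HasGradientAt F (gF x) x)
    (w : E) (ws : Fin n → E) (σ : ℝ) (hσ : 0 ≤ σ)
    {Ω : Type*} [MeasurableSpace Ω] (P : Measure Ω) [IsProbabilityMeasure P]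
    (g : Ω → E) (hgint : Integrable g P)
    (hmean : ∫ ω, g ω ∂P = (1 / (n : ℝ)) • ∑ j, gf j (ws j))
    (hvar : ∫ ω, ‖g ω - (1 / (n : ℝ)) • ∑ j, gf j (ws j)‖ ^ 2 ∂P ≤ σ ^ 2 / (n : ℝ))
    (η : ℝ) (hη0 : 0 < η) (hη1 : η ≤ 1 / L)
    (hFint : Integrable (fun ω => F (w - η • g ω)) P)
    (hg2int : Integrable (fun ω => ‖g ω‖ ^ 2) P) :
    ∫ ω, F (w - η • g ω) ∂P
      ≤ F w - (η / 2) * ‖gF w‖ ^ 2 + η ^ 2 * L * σ ^ 2 / (2 * (n : ℝ))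
        + (η * L ^ 2 / 2) * ((1 / (n : ℝ)) * ∑ j, ‖ws j - w‖ ^ 2) := by
  have hn' : (0 : ℝ) < n := by exact_mod_cast hn
  have hgrad : ∀ x, gF x = (1 / (n : ℝ)) • ∑ j, gf j x := by
    intro x
    refine (hgF x).unique ?_
    rw [hF, hasGradientAt_iff_hasFDerivAt]
    have hsum := (HasFDerivAt.fun_sum fun j (_ : j ∈ Finset.univ) =>
      (hgf j x).hasFDerivAt).const_mul (1 / (n : ℝ))
    simpa using hsum
  have hFLip : ∀ x y, ‖gF x - gF y‖ ≤ L * ‖x - y‖ := by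
    intro x y
    rw [hgrad, hgrad, ← smul_sub, ← Finset.sum_sub_distrib, norm_smul,
      Real.norm_of_nonneg (by positivity)]
    calc (1 / (n : ℝ)) * ‖∑ j, (gf j x - gf j y)‖
        ≤ (1 / (n : ℝ)) * ∑ _j : Fin n, L * ‖x - y‖ := by
          gcongr
          exact norm_sum_le_of_le _ fun j _ => hLip j x y
      _ = L * ‖x - y‖ := by
          simp
          field_simp
  set m : E := (1 / (n : ℝ)) • ∑ j, gf j (ws j) with hm
  have hdrift : ‖m - gF w‖ ^ 2 ≤ L ^ 2 * ((1 / (n : ℝ)) * ∑ j, ‖ws j - w‖ ^ 2) := by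
    rw [hm, hgrad, ← smul_sub, ← Finset.sum_sub_distrib]
    refine (norm_sq_average_le_s10 _).trans ?_
    rw [mul_left_comm, Finset.mul_sum _ _ (L ^ 2)]
    gcongr with j
    rw [← mul_pow]
    gcongr
    exact hLip j _ _
  have hpoint : ∀ ω, F (w - η • g ω)
      ≤ F w - η * ⟪gF w, g ω⟫_ℝ + L / 2 * η ^ 2 * ‖g ω‖ ^ 2 := by
    intro ω
    have h := le_add_inner_add_of_lipschitz_gradient hgF hFLip w (-(η • g ω))
    rw [← sub_eq_add_neg, inner_neg_right, real_inner_smul_right, norm_neg, norm_smul, mul_pow,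
      Real.norm_eq_abs, sq_abs] at h
    linarith
  have hinner : Integrable (fun ω => η * ⟪gF w, g ω⟫_ℝ) P := (hgint.const_inner _).const_mul η
  have hlin : Integrable (fun ω => F w - η * ⟪gF w, g ω⟫_ℝ) P := (integrable_const _).sub hinner
  have hquad : Integrable (fun ω => L / 2 * η ^ 2 * ‖g ω‖ ^ 2) P := hg2int.const_mul _
  have hint := integral_mono hFint (hlin.add hquad) hpoint
  simp only [Pi.add_apply] at hint
  rw [integral_add hlin hquad, integral_sub (integrable_const _) hinner, integral_const_mul,
    integral_const_mul, integral_inner hgint, hmean,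
    integral_norm_sq_eq_variance_add P hgint hg2int hmean] at hint
  simp only [integral_const, probReal_univ, one_smul] at hint
  have hpolar : ‖m - gF w‖ ^ 2 = ‖m‖ ^ 2 - 2 * ⟪gF w, m⟫_ℝ + ‖gF w‖ ^ 2 := by
    rw [norm_sub_sq_real, real_inner_comm]
  have hstep : L * η ≤ 1 := by
    rw [le_div_iff₀ hL] at hη1
    linarith
  have hvar' : L / 2 * η ^ 2 * ∫ ω, ‖g ω - m‖ ^ 2 ∂P ≤ η ^ 2 * L * σ ^ 2 / (2 * (n : ℝ)) := by
    calc L / 2 * η ^ 2 * ∫ ω, ‖g ω - m‖ ^ 2 ∂P ≤ L / 2 * η ^ 2 * (σ ^ 2 / n) := by gcongr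
      _ = η ^ 2 * L * σ ^ 2 / (2 * (n : ℝ)) := by field_simp
  have hmean_sq : η / 2 * ‖m‖ ^ 2 * (L * η) ≤ η / 2 * ‖m‖ ^ 2 :=
    mul_le_of_le_one_right (by positivity) hstep
  have hdrift' := mul_le_mul_of_nonneg_left hdrift (half_pos hη0).le
  rw [hpolar] at hdrift'
  linarith
end

section
/- Let μ > 0, let a ≥ 16 be a real number, let B ≥ 0, let T ≥ 1 be a natural number, and let r : ℕ → ℝ be a sequence of nonnegative reals such that r(t+1) ≤ (1 − 8/(t+a))·r(t) + 256·B/(μ²·(t+a)²) for every t with 1 ≤ t ≤ T. Then r(T+1) ≤ (a³/(T+a)³)·r(1) + 128·B·T·(T + 1 + 2a)/(μ²·(T+a)³). -/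
/-- One step of the contraction, multiplied by the weight `s ^ 3`. -/
theorem cube_mul_le_of_contraction {s C x y : ℝ} (hs : 1 ≤ s) (hx : 0 ≤ x)
    (h : y ≤ (1 - 8 / s) * x + 256 * C / s ^ 2) :
    s ^ 3 * y ≤ (s - 1) ^ 3 * x + 256 * C * s := by
  have hs0 : 0 < s := by linarith
  calc s ^ 3 * y ≤ s ^ 3 * ((1 - 8 / s) * x + 256 * C / s ^ 2) := by gcongr
    _ = s ^ 2 * (s - 8) * x + 256 * C * s := by field_simp
    _ ≤ (s - 1) ^ 3 * x + 256 * C * s := by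
      gcongr
      nlinarith

/-- The telescoped form of the weighted contraction. -/
theorem cube_mul_le_of_contraction_iterate {a C : ℝ} (ha : 0 ≤ a) {T : ℕ} {r : ℕ → ℝ}
    (hr0 : ∀ t, 0 ≤ r t)
    (hrec : ∀ t : ℕ, 1 ≤ t → t ≤ T →
      r (t + 1) ≤ (1 - 8 / ((t : ℝ) + a)) * r t + 256 * C / ((t : ℝ) + a) ^ 2) :
    ((T : ℝ) + a) ^ 3 * r (T + 1) ≤ a ^ 3 * r 1 + 128 * C * T * (T + 1 + 2 * a) := by
  induction T with
  | zero => simp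
  | succ n ih =>
    have hprev := ih fun t h1 h2 => hrec t h1 (by omega)
    have hs : (1 : ℝ) ≤ ((n + 1 : ℕ) : ℝ) + a := by
      push_cast
      linarith [n.cast_nonneg (α := ℝ)]
    have hstep := cube_mul_le_of_contraction hs (hr0 (n + 1)) (hrec (n + 1) (by omega) le_rfl)
    have hshift : ((n + 1 : ℕ) : ℝ) + a - 1 = n + a := by
      push_cast
      ring
    rw [hshift] at hstep
    push_cast at hstep ⊢
    linarith

/-- weighted telescoping / contraction bound for the last iterate.
If `r(t+1) ≤ (1 − 8/(t+a))·r(t) + 256·B/(μ²(t+a)²)` for `1 ≤ t ≤ T`, then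
`r(T+1) ≤ (a³/(T+a)³)·r(1) + 128·B·T·(T+1+2a)/(μ²(T+a)³)`. -/
theorem last_iterate_contraction_bound
    (μ a : ℝ) (hμ : 0 < μ) (ha : 16 ≤ a) (B : ℝ) (hB : 0 ≤ B)
    (T : ℕ) (hT : 1 ≤ T) (r : ℕ → ℝ) (hr0 : ∀ t, 0 ≤ r t)
    (hrec : ∀ t : ℕ, 1 ≤ t → t ≤ T →
      r (t + 1) ≤ (1 - 8 / ((t : ℝ) + a)) * r t + 256 * B / (μ ^ 2 * ((t : ℝ) + a) ^ 2)) :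
    r (T + 1)
      ≤ (a ^ 3 / (((T : ℝ) + a) ^ 3)) * r 1
        + 128 * B * (T : ℝ) * ((T : ℝ) + 1 + 2 * a) / (μ ^ 2 * ((T : ℝ) + a) ^ 3) := by
  have hs : 0 < (T : ℝ) + a := by positivity
  have h := cube_mul_le_of_contraction_iterate (a := a) (C := B / μ ^ 2) (by linarith) hr0
    fun t h1 h2 => (hrec t h1 h2).trans_eq (by rw [← mul_div_assoc, div_div])
  rw [mul_comm, ← le_div_iff₀ (by positivity)] at h
  refine h.trans_eq ?_
  field_simp
end

section
/- Let μ > 0, let a ≥ 16 be a real number, let B ≥ 0, let T ≥ 1 be a natural number, and let r, e : ℕ → ℝ be sequences of nonnegative reals such that r(t+1) ≤ (1 − 8/(t+a))·r(t) − (16/(μ·(t+a)))·e(t) + 256·B/(μ²·(t+a)²) for every t with 1 ≤ t ≤ T. Then Σ_{t=1}^{T} (t+a)²·e(t) ≤ (μ·a³/16)·r(1) + (16·B/μ)·(T·(T+1)/2 + a·T). -/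
/-- One descent step, multiplied by `μ * x ^ 3 / 16`, for the potential `μ / 16 * x ^ 3 * r`. -/
theorem weighted_descent_step {μ x B r r' e : ℝ} (hμ : 0 < μ) (hx : 1 ≤ x) (hr : 0 ≤ r)
    (h : r' ≤ (1 - 8 / x) * r - (16 / (μ * x)) * e + 256 * B / (μ ^ 2 * x ^ 2)) :
    x ^ 2 * e + μ / 16 * x ^ 3 * r' ≤ μ / 16 * (x - 1) ^ 3 * r + 16 * B / μ * x := by
  have hx0 : 0 < x := by linarith
  have hmul := mul_le_mul_of_nonneg_left h (by positivity : 0 ≤ μ / 16 * x ^ 3)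
  have hexpand : μ / 16 * x ^ 3 *
      ((1 - 8 / x) * r - (16 / (μ * x)) * e + 256 * B / (μ ^ 2 * x ^ 2)) =
      μ / 16 * (x ^ 3 - 8 * x ^ 2) * r - x ^ 2 * e + 16 * B / μ * x := by
    field_simp
    ring
  have hcube : μ / 16 * (x ^ 3 - 8 * x ^ 2) * r ≤ μ / 16 * (x - 1) ^ 3 * r := by
    gcongr
    nlinarith
  linarith

/-- weighted telescoping argument converting per-step descent into a bound
on the weighted sum of suboptimalities. If
`r(t+1) ≤ (1 − 8/(t+a))·r(t) − (16/(μ(t+a)))·e(t) + 256·B/(μ²(t+a)²)` for `1 ≤ t ≤ T`,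
then `Σ_{t=1}^{T} (t+a)²·e(t) ≤ (μa³/16)·r(1) + (16B/μ)·(T(T+1)/2 + aT)`. -/
theorem weighted_suboptimality_sum_bound
    (μ a : ℝ) (hμ : 0 < μ) (ha : 16 ≤ a) (B : ℝ) (hB : 0 ≤ B)
    (T : ℕ) (hT : 1 ≤ T) (r e : ℕ → ℝ) (hr0 : ∀ t, 0 ≤ r t) (he0 : ∀ t, 0 ≤ e t)
    (hrec : ∀ t : ℕ, 1 ≤ t → t ≤ T →
      r (t + 1) ≤ (1 - 8 / ((t : ℝ) + a)) * r t - (16 / (μ * ((t : ℝ) + a))) * e t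
        + 256 * B / (μ ^ 2 * ((t : ℝ) + a) ^ 2)) :
    ∑ t ∈ Finset.Icc 1 T, ((t : ℝ) + a) ^ 2 * e t
      ≤ (μ * a ^ 3 / 16) * r 1 + (16 * B / μ) * ((T : ℝ) * ((T : ℝ) + 1) / 2 + a * (T : ℝ)) := by
  have key : ∀ n : ℕ, n ≤ T →
      ∑ t ∈ Finset.Icc 1 n, ((t : ℝ) + a) ^ 2 * e t + μ / 16 * ((n : ℝ) + a) ^ 3 * r (n + 1)
        ≤ (μ * a ^ 3 / 16) * r 1
          + (16 * B / μ) * ((n : ℝ) * ((n : ℝ) + 1) / 2 + a * (n : ℝ)) := by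
    intro n
    induction n with
    | zero =>
      intro _
      simp only [Finset.Icc_eq_empty_of_lt Nat.zero_lt_one, Finset.sum_empty, Nat.cast_zero,
        zero_add]
      exact le_of_eq (by ring)
    | succ n ih =>
      intro hn
      have hx : (1 : ℝ) ≤ ((n + 1 : ℕ) : ℝ) + a := by
        have : (0 : ℝ) ≤ ((n + 1 : ℕ) : ℝ) := Nat.cast_nonneg _
        linarith
      have hstep := weighted_descent_step hμ hx (hr0 (n + 1)) (hrec (n + 1) (by omega) hn)
      have hprev := ih (by omega)
      rw [Finset.sum_Icc_succ_top (by omega)]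
      push_cast at hstep ⊢
      rw [show (n : ℝ) + 1 + a - 1 = n + a by ring] at hstep
      linear_combination hstep + hprev
  have hpot : 0 ≤ μ / 16 * ((T : ℝ) + a) ^ 3 * r (T + 1) := by
    have := hr0 (T + 1)
    positivity
  linarith [key T le_rfl]
end
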